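/- Let A be a complete normed unital ring that is a normed algebra over ℝ, and let x, y : ℝ → A be functions with x(0) = y(0) = 1 that are differentiable at 0 with derivatives X and Y respectively. Define c : ℝ → A by c(t) = x(√t)⁻¹ y(√t)⁻¹ x(√t) y(√t) for t ≥ 0 and c(t) = (x(√(−t))⁻¹ y(√(−t))⁻¹ x(√(−t)) y(√(−t)))⁻¹ for t < 0, where inverses are interpreted via the everywhere-defined ring inverse operation. Then c is differentiable at 0 with derivative XY − YX. -/

import Mathlib

open Filter Topology

theorem tendsto_ringInverse_one {A α : Type*} [NormedRing A] [CompleteSpace A] {l : Filter α}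
    {f : α → A} (hf : Tendsto f l (𝓝 1)) : Tendsto (fun s => Ring.inverse (f s)) l (𝓝 1) := by
  have h := NormedRing.inverse_continuousAt (1 : Aˣ)
  rw [ContinuousAt, Units.val_one, Ring.inverse_one] at h
  exact h.comp hf

theorem eventually_isUnit_of_tendsto_one {A α : Type*} [NormedRing A] [CompleteSpace A]
    {l : Filter α} {f : α → A} (hf : Tendsto f l (𝓝 1)) : ∀ᶠ s in l, IsUnit (f s) :=
  hf.eventually (Units.isOpen.mem_nhds isUnit_one)

theorem ringInverse_commutator_sub_one {A : Type*} [Ring A] {a b : A}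
    (ha : IsUnit a) (hb : IsUnit b) :
    Ring.inverse a * Ring.inverse b * a * b - 1 =
      Ring.inverse a * Ring.inverse b * ((a - 1) * (b - 1) - (b - 1) * (a - 1)) := by
  have h : Ring.inverse a * Ring.inverse b * (b * a) = 1 := by
    rw [mul_assoc, Ring.inverse_mul_cancel_left _ _ hb, Ring.inverse_mul_cancel _ ha]
  have h' : (a - 1) * (b - 1) - (b - 1) * (a - 1) = a * b - b * a := by noncomm_ring
  rw [h', mul_sub, h, mul_assoc _ a b]

theorem ringInverse_sub_one {A : Type*} [Ring A] {a : A} (ha : IsUnit a) :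
    Ring.inverse a - 1 = -(Ring.inverse a * (a - 1)) := by
  rw [mul_sub, Ring.inverse_mul_cancel _ ha, mul_one, neg_sub]

section

variable {A : Type*} [NormedRing A] [NormedAlgebra ℝ A] {x y : ℝ → A} {X Y : A}

theorem tendsto_smul_sub_one (hx0 : x 0 = 1) (hx : HasDerivAt x X 0) :
    Tendsto (fun s : ℝ => s⁻¹ • (x s - 1)) (𝓝[≠] 0) (𝓝 X) := by
  simpa [hx0] using hx.tendsto_slope_zero

theorem tendsto_one_of_hasDerivAt (hx0 : x 0 = 1) (hx : HasDerivAt x X 0) :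
    Tendsto x (𝓝[≠] 0) (𝓝 1) :=
  hx0 ▸ hx.continuousAt.tendsto.mono_left nhdsWithin_le_nhds

variable [CompleteSpace A]

theorem tendsto_commutator_one (hx0 : x 0 = 1) (hy0 : y 0 = 1)
    (hx : HasDerivAt x X 0) (hy : HasDerivAt y Y 0) :
    Tendsto (fun s => Ring.inverse (x s) * Ring.inverse (y s) * x s * y s) (𝓝[≠] 0) (𝓝 1) := by
  have hx1 := tendsto_one_of_hasDerivAt hx0 hx
  have hy1 := tendsto_one_of_hasDerivAt hy0 hy
  simpa using
    (((tendsto_ringInverse_one hx1).mul (tendsto_ringInverse_one hy1)).mul hx1).mul hy1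

theorem tendsto_commutator_sub_one (hx0 : x 0 = 1) (hy0 : y 0 = 1)
    (hx : HasDerivAt x X 0) (hy : HasDerivAt y Y 0) :
    Tendsto (fun s : ℝ => (s ^ 2)⁻¹ •
        (Ring.inverse (x s) * Ring.inverse (y s) * x s * y s - 1))
      (𝓝[≠] 0) (𝓝 (X * Y - Y * X)) := by
  have hx1 := tendsto_one_of_hasDerivAt hx0 hx
  have hy1 := tendsto_one_of_hasDerivAt hy0 hy
  have hX := tendsto_smul_sub_one hx0 hx
  have hY := tendsto_smul_sub_one hy0 hy
  have h := ((tendsto_ringInverse_one hx1).mul (tendsto_ringInverse_one hy1)).mul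
    ((hX.mul hY).sub (hY.mul hX))
  rw [one_mul, one_mul] at h
  refine h.congr' ?_
  filter_upwards [eventually_isUnit_of_tendsto_one hx1,
    eventually_isUnit_of_tendsto_one hy1] with s hxs hys
  rw [ringInverse_commutator_sub_one hxs hys, smul_mul_smul_comm, smul_mul_smul_comm, ← smul_sub,
    mul_smul_comm, ← mul_inv, ← sq]

theorem tendsto_ringInverse_commutator_sub_one (hx0 : x 0 = 1) (hy0 : y 0 = 1)
    (hx : HasDerivAt x X 0) (hy : HasDerivAt y Y 0) :
    Tendsto (fun s : ℝ => -(s ^ 2)⁻¹ •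
        (Ring.inverse (Ring.inverse (x s) * Ring.inverse (y s) * x s * y s) - 1))
      (𝓝[≠] 0) (𝓝 (X * Y - Y * X)) := by
  have h1 := tendsto_commutator_one hx0 hy0 hx hy
  have h := (tendsto_ringInverse_one h1).mul (tendsto_commutator_sub_one hx0 hy0 hx hy)
  rw [one_mul] at h
  refine h.congr' ?_
  filter_upwards [eventually_isUnit_of_tendsto_one h1] with s hs
  rw [ringInverse_sub_one hs, neg_smul_neg, mul_smul_comm]

end

theorem tendsto_sqrt_nhdsGT_zero : Tendsto Real.sqrt (𝓝[>] 0) (𝓝[≠] 0) := by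
  refine tendsto_nhdsWithin_iff.2 ⟨?_, ?_⟩
  · simpa using (Real.continuous_sqrt.tendsto 0).mono_left nhdsWithin_le_nhds
  · filter_upwards [self_mem_nhdsWithin] with t ht
    exact (Real.sqrt_pos.2 ht).ne'

theorem tendsto_sqrt_neg_nhdsLT_zero :
    Tendsto (fun t : ℝ => Real.sqrt (-t)) (𝓝[<] 0) (𝓝[≠] 0) := by
  refine tendsto_sqrt_nhdsGT_zero.comp ?_
  simpa using tendsto_neg_nhdsLT (a := (0 : ℝ))

/-- If `x, y : ℝ → A` satisfy `x 0 = y 0 = 1` and are differentiable at `0` with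
derivatives `X` and `Y`, then the curve
`c(t) = x(√t)⁻¹y(√t)⁻¹x(√t)y(√t)` for `t ≥ 0`,
`c(t) = (x(√(-t))⁻¹y(√(-t))⁻¹x(√(-t))y(√(-t)))⁻¹` for `t < 0`
(with the junk-valued ring inverse) is differentiable at `0` with derivative `XY - YX`. -/
theorem stmt_6 {A : Type*} [NormedRing A] [CompleteSpace A] [NormedAlgebra ℝ A]
    (x y : ℝ → A) (X Y : A) (hx0 : x 0 = 1) (hy0 : y 0 = 1)
    (hx : HasDerivAt x X 0) (hy : HasDerivAt y Y 0) :
    HasDerivAt (fun t : ℝ =>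
        if 0 ≤ t then
          Ring.inverse (x (Real.sqrt t)) * Ring.inverse (y (Real.sqrt t)) *
            x (Real.sqrt t) * y (Real.sqrt t)
        else
          Ring.inverse
            (Ring.inverse (x (Real.sqrt (-t))) * Ring.inverse (y (Real.sqrt (-t))) *
              x (Real.sqrt (-t)) * y (Real.sqrt (-t))))
      (X * Y - Y * X) 0 := by
  rw [hasDerivAt_iff_tendsto_slope_zero, ← nhdsLT_sup_nhdsGT, tendsto_sup]
  constructor
  · refine ((tendsto_ringInverse_commutator_sub_one hx0 hy0 hx hy).comp
      tendsto_sqrt_neg_nhdsLT_zero).congr' ?_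
    filter_upwards [self_mem_nhdsWithin] with t ht
    have ht' : t < 0 := ht
    simp [hx0, hy0, ht'.not_ge, Real.sq_sqrt (neg_nonneg.2 ht'.le), inv_neg]
  · refine ((tendsto_commutator_sub_one hx0 hy0 hx hy).comp tendsto_sqrt_nhdsGT_zero).congr' ?_
    filter_upwards [self_mem_nhdsWithin] with t ht
    have ht' : 0 < t := ht
    simp [hx0, hy0, ht'.le, Real.sq_sqrt ht'.le]
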